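/- arXiv:2410.07424 — 3 statements merged into one kernel-verified Lean document; each statement's English description precedes it below -/
import Mathlib

section
/- Let X be a nonempty compact metric space, α : X → X a minimal homeomorphism, and Y ⊆ X a closed subset with non-empty interior. Then for every x ∈ X there exist a unique y ∈ Y and a unique integer i with 0 ≤ i < r_Y(y) such that x = α^i(y). Equivalently, writing r_1 < ⋯ < r_K for the distinct first return times and Y_k := {y ∈ Y : r_Y(y) = r_k}, the sets α^i(Y_k) for 1 ≤ k ≤ K and 0 ≤ i ≤ r_k − 1 form a partition of X (the Rokhlin tower partition). -/
open Set

/-- A homeomorphism of a topological space is *minimal* if every (two-sided) orbit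
`{α^n x : n ∈ ℤ}` is dense. -/
def IsMinimalHomeo {X : Type*} [TopologicalSpace X] (α : X ≃ₜ X) : Prop :=
  ∀ x : X, Dense (Set.range fun n : ℤ => (α.toEquiv ^ n) x)

/-- The first return time of `x` to `Y` under `α`: the least `n ≥ 1` with `α^n x ∈ Y`
(the `sInf` of the empty set being `0` when no such `n` exists). -/
noncomputable def firstReturn {X : Type*} [TopologicalSpace X] (α : X ≃ₜ X) (Y : Set X)
    (x : X) : ℕ :=
  sInf {n : ℕ | 1 ≤ n ∧ (α.toEquiv ^ n) x ∈ Y}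

/-- `returnSet α Y r = Y_r = {y ∈ Y | r_Y(y) = r}`. -/
def returnSet {X : Type*} [TopologicalSpace X] (α : X ≃ₜ X) (Y : Set X) (r : ℕ) : Set X :=
  {y : X | y ∈ Y ∧ firstReturn α Y y = r}

theorem continuous_toEquiv_zpow {X : Type*} [TopologicalSpace X] (α : X ≃ₜ X) (n : ℤ) :
    Continuous fun x => (α.toEquiv ^ n) x := by
  have hnat : ∀ (β : X ≃ₜ X) (k : ℕ), Continuous fun x => (β.toEquiv ^ k) x := by
    intro β k
    induction k with
    | zero => exact continuous_id
    | succ k ih =>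
      simp only [pow_succ, Equiv.Perm.mul_apply]
      exact ih.comp β.continuous
  cases n with
  | ofNat k => exact hnat α k
  | negSucc k =>
    simp only [zpow_negSucc, ← inv_pow]
    exact hnat α.symm (k + 1)

/-- In a compact minimal system, orbits hit a nonempty open set with uniformly bounded gaps. -/
theorem IsMinimalHomeo.exists_bounded_hitting {X : Type*} [TopologicalSpace X] [CompactSpace X]
    {α : X ≃ₜ X} (hmin : IsMinimalHomeo α) {U : Set X} (hU : IsOpen U) (hne : U.Nonempty) :
    ∃ N : ℕ, ∀ x : X, ∃ n : ℤ, |n| ≤ N ∧ (α.toEquiv ^ n) x ∈ U := by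
  obtain ⟨F, hF⟩ := isCompact_univ.elim_finite_subcover
    (fun n : ℤ => (fun x => (α.toEquiv ^ n) x) ⁻¹' U)
    (fun n => hU.preimage (continuous_toEquiv_zpow α n))
    (fun x _ => by
      obtain ⟨_, hy, n, rfl⟩ := (hmin x).inter_open_nonempty U hU hne
      exact mem_iUnion.2 ⟨n, hy⟩)
  refine ⟨F.sup Int.natAbs, fun x => ?_⟩
  obtain ⟨n, hn, hx⟩ := mem_iUnion₂.1 (hF (mem_univ x))
  have hle := Finset.le_sup (f := Int.natAbs) hn
  exact ⟨n, by grind, hx⟩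

theorem IsMinimalHomeo.exists_pos_pow_mem {X : Type*} [TopologicalSpace X] [CompactSpace X]
    {α : X ≃ₜ X} (hmin : IsMinimalHomeo α) {U : Set X} (hU : IsOpen U) (hne : U.Nonempty)
    (x : X) : ∃ n : ℕ, 1 ≤ n ∧ (α.toEquiv ^ n) x ∈ U := by
  obtain ⟨N, hN⟩ := hmin.exists_bounded_hitting hU hne
  obtain ⟨n, hn, hx⟩ := hN ((α.toEquiv ^ (N + 1 : ℤ)) x)
  rw [← Equiv.Perm.mul_apply, ← zpow_add] at hx
  obtain ⟨m, hm⟩ := Int.eq_ofNat_of_zero_le (a := n + (N + 1)) (by grind)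
  rw [hm, zpow_natCast] at hx
  exact ⟨m, by grind, hx⟩

theorem IsMinimalHomeo.exists_pow_apply_eq {X : Type*} [TopologicalSpace X] [CompactSpace X]
    {α : X ≃ₜ X} (hmin : IsMinimalHomeo α) {U : Set X} (hU : IsOpen U) (hne : U.Nonempty)
    (x : X) : ∃ n : ℕ, ∃ y ∈ U, x = (α.toEquiv ^ n) y := by
  obtain ⟨N, hN⟩ := hmin.exists_bounded_hitting hU hne
  obtain ⟨n, hn, hx⟩ := hN ((α.toEquiv ^ (-N : ℤ)) x)
  rw [← Equiv.Perm.mul_apply, ← zpow_add] at hx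
  obtain ⟨m, hm⟩ := Int.eq_ofNat_of_zero_le (a := -(n + -N)) (by grind)
  refine ⟨m, _, hx, ?_⟩
  rw [← zpow_natCast, ← hm, ← Equiv.Perm.mul_apply, ← zpow_add]
  simp

/-- No point of `Y` returns to `Y` strictly before its first return time. -/
theorem pow_apply_notMem_of_lt_firstReturn {X : Type*} [TopologicalSpace X] {α : X ≃ₜ X}
    {Y : Set X} {x : X} {n : ℕ} (hn : 1 ≤ n) (hlt : n < firstReturn α Y x) :
    (α.toEquiv ^ n) x ∉ Y :=
  fun h => Nat.notMem_of_lt_sInf hlt ⟨hn, h⟩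

theorem le_of_pow_apply_eq_of_lt_firstReturn {X : Type*} [TopologicalSpace X] {α : X ≃ₜ X}
    {Y : Set X} {y z : X} {i j : ℕ} (hy : y ∈ Y) (hj : j < firstReturn α Y z)
    (h : (α.toEquiv ^ i) y = (α.toEquiv ^ j) z) : j ≤ i := by
  by_contra! hij
  refine pow_apply_notMem_of_lt_firstReturn (x := z) (n := j - i) (by omega)
    ((Nat.sub_le j i).trans_lt hj) ?_
  rw [← Nat.add_sub_of_le hij.le, pow_add, Equiv.Perm.mul_apply] at h
  exact (α.toEquiv ^ i).injective h ▸ hy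

/-- every `x ∈ X` can be written uniquely as `x = α^i y` with `y ∈ Y` and
`0 ≤ i < r_Y(y)`; i.e. the Rokhlin tower sets `α^i(Y_k)` partition `X`. -/
theorem rokhlin_tower_partition {X : Type*} [MetricSpace X] [CompactSpace X]
    [Nonempty X] (α : X ≃ₜ X) (hmin : IsMinimalHomeo α) (Y : Set X)
    (hYclosed : IsClosed Y) (hYint : (interior Y).Nonempty) :
    ∀ x : X, ∃! p : X × ℕ,
      p.1 ∈ Y ∧ p.2 < firstReturn α Y p.1 ∧ x = (α.toEquiv ^ p.2) p.1 := by
  intro x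
  have hback : ∃ n : ℕ, ∃ y ∈ Y, x = (α.toEquiv ^ n) y := by
    obtain ⟨n, y, hy, hx⟩ := hmin.exists_pow_apply_eq isOpen_interior hYint x
    exact ⟨n, y, interior_subset hy, hx⟩
  classical
  obtain ⟨y, hy, hx⟩ := Nat.find_spec hback
  refine ⟨(y, Nat.find hback), ⟨hy, ?_, hx⟩, ?_⟩
  · have hret : {n : ℕ | 1 ≤ n ∧ (α.toEquiv ^ n) y ∈ Y}.Nonempty := by
      obtain ⟨n, hn, hny⟩ := hmin.exists_pos_pow_mem isOpen_interior hYint y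
      exact ⟨n, hn, interior_subset hny⟩
    obtain ⟨hpos, hmem⟩ : 1 ≤ firstReturn α Y y ∧ (α.toEquiv ^ firstReturn α Y y) y ∈ Y :=
      Nat.sInf_mem hret
    refine lt_of_not_ge fun (hle : firstReturn α Y y ≤ Nat.find hback) => ?_
    refine Nat.find_min hback (m := Nat.find hback - firstReturn α Y y) (by omega)
      ⟨_, hmem, ?_⟩
    rw [← Equiv.Perm.mul_apply, ← pow_add, Nat.sub_add_cancel hle]
    exact hx
  · rintro ⟨z, j⟩ ⟨hz, hj, hxz⟩
    obtain rfl : j = Nat.find hback :=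
      le_antisymm (le_of_pow_apply_eq_of_lt_firstReturn hy hj (hx.symm.trans hxz))
        (Nat.find_min' hback ⟨z, hz, hxz⟩)
    exact Prod.ext ((α.toEquiv ^ Nat.find hback).injective (hxz.symm.trans hx)) rfl
end

section
/- Let X be a nonempty compact metric space, α : X → X a minimal homeomorphism, and Y ⊆ X a closed subset with non-empty interior. Let r ≥ 1 and let x ∈ closure(Y_r) \ Y_r, where Y_r = {y ∈ Y : r_Y(y) = r}. Then there exist a unique integer m ≥ 2 and unique integers 0 = R_0 < R_1 < ⋯ < R_m = r such that for every 1 ≤ s ≤ m one has α^{R_{s−1}}(x) ∈ Y and r_Y(α^{R_{s−1}}(x)) = R_s − R_{s−1}; moreover R_s − R_{s−1} < r for every 1 ≤ s ≤ m (the boundary decomposition of x). -/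
open Set

section Return

variable {X : Type*} [TopologicalSpace X] (α : X ≃ₜ X) {Y : Set X}

theorem continuous_toEquiv_pow (n : ℕ) : Continuous fun x => (α.toEquiv ^ n) x := by
  induction n with
  | zero => exact continuous_id
  | succ n ih =>
    simp only [pow_succ', Equiv.Perm.mul_apply]
    exact α.continuous.comp ih

theorem firstReturn_spec {x : X} {n : ℕ} (hn : 1 ≤ n) (hx : (α.toEquiv ^ n) x ∈ Y) :
    1 ≤ firstReturn α Y x ∧ firstReturn α Y x ≤ n ∧
      (α.toEquiv ^ firstReturn α Y x) x ∈ Y := by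
  have hne : {k : ℕ | 1 ≤ k ∧ (α.toEquiv ^ k) x ∈ Y}.Nonempty := ⟨n, hn, hx⟩
  exact ⟨(Nat.sInf_mem hne).1, Nat.sInf_le ⟨hn, hx⟩, (Nat.sInf_mem hne).2⟩

theorem firstReturn_orbit_spec {x : X} {n r : ℕ} (hn : n < r) (hx : (α.toEquiv ^ r) x ∈ Y) :
    1 ≤ firstReturn α Y ((α.toEquiv ^ n) x) ∧
      n + firstReturn α Y ((α.toEquiv ^ n) x) ≤ r ∧
      (α.toEquiv ^ (n + firstReturn α Y ((α.toEquiv ^ n) x))) x ∈ Y := by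
  have hadd (k : ℕ) : (α.toEquiv ^ k) ((α.toEquiv ^ n) x) = (α.toEquiv ^ (n + k)) x := by
    rw [← Equiv.Perm.mul_apply, ← pow_add, add_comm]
  have hr : (α.toEquiv ^ (r - n)) ((α.toEquiv ^ n) x) ∈ Y := by
    rwa [hadd, Nat.add_sub_cancel' hn.le]
  obtain ⟨h1, h2, h3⟩ := firstReturn_spec α (by omega) hr
  exact ⟨h1, by omega, by rwa [← hadd]⟩

theorem pow_mem_of_mem_returnSet {r : ℕ} (hr : 1 ≤ r) {y : X} (hy : y ∈ returnSet α Y r) :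
    (α.toEquiv ^ r) y ∈ Y := by
  have hpos : 0 < sInf {n : ℕ | 1 ≤ n ∧ (α.toEquiv ^ n) y ∈ Y} :=
    hr.trans_eq hy.2.symm
  have h := Nat.sInf_mem (Nat.nonempty_of_pos_sInf hpos)
  exact hy.2 ▸ h.2

theorem mem_of_mem_closure_returnSet (hY : IsClosed Y) {r : ℕ} (hr : 1 ≤ r) {x : X}
    (hx : x ∈ closure (returnSet α Y r)) : x ∈ Y ∧ (α.toEquiv ^ r) x ∈ Y :=
  closure_minimal (t := Y ∩ (fun x => (α.toEquiv ^ r) x) ⁻¹' Y)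
    (fun _ hy => ⟨hy.1, pow_mem_of_mem_returnSet α hr hy⟩)
    (hY.inter (hY.preimage (continuous_toEquiv_pow α r))) hx

end Return

theorem lt_of_forall_lt_succ {R : ℕ → ℕ} {m : ℕ} (h : ∀ s < m, R s < R (s + 1)) {s : ℕ}
    (hs : s < m) : R s < R m :=
  strictMonoOn_of_lt_add_one (s := Set.Iic m) Set.ordConnected_Iic
    (fun a _ _ ha => h a ha) hs.le Set.self_mem_Iic hs

/-- boundary decomposition. If `x ∈ closure(Y_r) \ Y_r`, then there are a
unique `m ≥ 2` and unique integers `0 = R 0 < R 1 < ⋯ < R m = r` such that for each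
`1 ≤ s ≤ m` one has `α^(R (s-1)) x ∈ Y` and `r_Y(α^(R (s-1)) x) = R s − R (s-1)`, and
moreover each increment `R s − R (s-1)` is `< r`. -/
theorem boundary_decomposition {X : Type*} [MetricSpace X] [CompactSpace X]
    [Nonempty X] (α : X ≃ₜ X) (hmin : IsMinimalHomeo α) (Y : Set X)
    (hYclosed : IsClosed Y) (hYint : (interior Y).Nonempty)
    (r : ℕ) (hr : 1 ≤ r) (x : X) (hx : x ∈ closure (returnSet α Y r) \ returnSet α Y r) :
    ∃ m : ℕ, ∃ R : ℕ → ℕ,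
      (2 ≤ m ∧ R 0 = 0 ∧ R m = r ∧ (∀ s < m, R s < R (s + 1)) ∧
        ∀ s < m, (α.toEquiv ^ R s) x ∈ Y ∧
          firstReturn α Y ((α.toEquiv ^ R s) x) = R (s + 1) - R s ∧ R (s + 1) - R s < r) ∧
      ∀ m' : ℕ, ∀ R' : ℕ → ℕ,
        (2 ≤ m' ∧ R' 0 = 0 ∧ R' m' = r ∧ (∀ s < m', R' s < R' (s + 1)) ∧
          ∀ s < m', (α.toEquiv ^ R' s) x ∈ Y ∧
            firstReturn α Y ((α.toEquiv ^ R' s) x) = R' (s + 1) - R' s ∧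
            R' (s + 1) - R' s < r) →
        m' = m ∧ ∀ s ≤ m, R' s = R s := by
  obtain ⟨hxc, hxn⟩ := hx
  obtain ⟨hxY, hxr⟩ := mem_of_mem_closure_returnSet α hYclosed hr hxc
  set f : ℕ → ℕ := fun n => firstReturn α Y ((α.toEquiv ^ n) x)
  have hstep : ∀ n < r, 1 ≤ f n ∧ n + f n ≤ r ∧ (α.toEquiv ^ (n + f n)) x ∈ Y :=
    fun n hn => firstReturn_orbit_spec α hn hxr
  have hf0 : f 0 ≠ r := fun h => hxn ⟨hxY, h⟩
  obtain ⟨R, hR0, hRs⟩ : ∃ R : ℕ → ℕ, R 0 = 0 ∧ ∀ s, R (s + 1) = R s + f (R s) :=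
    ⟨fun s => (fun n => n + f n)^[s] 0, rfl, fun s => Function.iterate_succ_apply' _ _ _⟩
  have hex : ∃ s, r ≤ R s := by
    by_contra! hlt
    have hge : ∀ s, s ≤ R s := by
      intro s
      induction s with
      | zero => omega
      | succ s ih => have := (hstep _ (hlt s)).1; rw [hRs]; omega
    exact absurd (hge r) (hlt r).not_ge
  obtain ⟨m, hm, hlt⟩ : ∃ m, r ≤ R m ∧ ∀ s < m, R s < r :=
    ⟨Nat.find hex, Nat.find_spec hex, fun s hs => not_le.mp (Nat.find_min hex hs)⟩
  have hmem : ∀ s ≤ m, R s ≤ r ∧ (α.toEquiv ^ R s) x ∈ Y := by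
    intro s hs
    induction s with
    | zero => rw [hR0]; exact ⟨r.zero_le, hxY⟩
    | succ s _ => rw [hRs]; exact (hstep _ (hlt s hs)).2
  have hR1 : R 1 < r := by
    have := (hstep 0 hr).2.1
    have h1 : R 1 = R 0 + f (R 0) := hRs 0
    rw [hR0] at h1
    omega
  have hm2 : 2 ≤ m := by
    by_contra! h
    interval_cases m <;> omega
  refine ⟨m, R, ⟨hm2, hR0, (hmem m le_rfl).1.antisymm hm, fun s hs => ?_,
    fun s hs => ⟨(hmem s hs.le).2, ?_, ?_⟩⟩, ?_⟩
  · have := (hstep _ (hlt s hs)).1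
    rw [hRs]; omega
  · rw [hRs, Nat.add_sub_cancel_left]
  · have := (hstep _ (hlt s hs)).2.1
    rw [hRs, Nat.add_sub_cancel_left]
    rcases Nat.eq_zero_or_pos (R s) with h0 | h0
    · rw [h0] at this ⊢; omega
    · omega
  · rintro m' R' ⟨-, hR'0, hR'm, hmono, hret⟩
    have heq : ∀ s ≤ m', R' s = R s := by
      intro s hs
      induction s with
      | zero => rw [hR0, hR'0]
      | succ s ih =>
        have h1 : f (R' s) = R' (s + 1) - R' s := (hret s hs).2.1
        have h2 := hmono s hs
        rw [hRs, ← ih (by omega), h1]; omega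
    have hmm : m' = m := by
      rcases lt_trichotomy m' m with h | h | h
      · have := hlt m' h
        rw [← heq m' le_rfl] at this; omega
      · exact h
      · have := lt_of_forall_lt_succ hmono h
        rw [heq m h.le] at this; omega
    subst hmm
    exact ⟨rfl, heq⟩
end

section
/- Let X be a nonempty compact metric space, α : X → X a minimal homeomorphism, and Y ⊆ X a closed subset with non-empty interior. Let r' < r be integers with r' ≥ 1, let z ∈ closure(Y_{r'}) and y ∈ Y_r, where Y_s = {w ∈ Y : r_Y(w) = s}, and let integers p, i satisfy 0 ≤ p < r' and 0 ≤ i < r. Then α^p(z) ≠ α^i(y); that is, the sets α^p(closure(Y_{r'})) for 0 ≤ p < r' are disjoint from the sets α^i(Y_r) for 0 ≤ i < r. -/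
open Set

theorem returnSet_subset_preimage {X : Type*} [TopologicalSpace X] (α : X ≃ₜ X) (Y : Set X)
    {r : ℕ} (hr : 1 ≤ r) : returnSet α Y r ⊆ {x | (α.toEquiv ^ r) x ∈ Y} := by
  rintro x ⟨-, hx⟩
  have hpos : 0 < sInf {n : ℕ | 1 ≤ n ∧ (α.toEquiv ^ n) x ∈ Y} := by
    change 0 < firstReturn α Y x
    omega
  have hmem := Nat.sInf_mem (Nat.nonempty_of_pos_sInf hpos)
  change 1 ≤ firstReturn α Y x ∧ (α.toEquiv ^ firstReturn α Y x) x ∈ Y at hmem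
  exact hx ▸ hmem.2

theorem continuous_toEquiv_pow_s11 {X : Type*} [TopologicalSpace X] (α : X ≃ₜ X) (n : ℕ) :
    Continuous (α.toEquiv ^ n : Equiv.Perm X) := by
  rw [Equiv.Perm.coe_pow]
  exact α.continuous.iterate n

/-- for return times `r' < r`, the sets `α^p(closure(Y_{r'}))` with
`0 ≤ p < r'` are disjoint from the sets `α^i(Y_r)` with `0 ≤ i < r`. -/
theorem closure_tower_disjoint {X : Type*} [MetricSpace X] [CompactSpace X]
    [Nonempty X] (α : X ≃ₜ X) (hmin : IsMinimalHomeo α) (Y : Set X)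
    (hYclosed : IsClosed Y) (hYint : (interior Y).Nonempty)
    (r' r : ℕ) (hr' : 1 ≤ r') (hlt : r' < r)
    (z : X) (hz : z ∈ closure (returnSet α Y r'))
    (y : X) (hy : y ∈ returnSet α Y r)
    (p i : ℕ) (hp : p < r') (hi : i < r) :
    (α.toEquiv ^ p) z ≠ (α.toEquiv ^ i) y := by
  obtain ⟨hzY, hzr⟩ : z ∈ Y ∧ (α.toEquiv ^ r') z ∈ Y :=
    ⟨closure_minimal (fun _ h => h.1) hYclosed hz,
      closure_minimal (returnSet_subset_preimage α Y hr')
        (hYclosed.preimage (continuous_toEquiv_pow_s11 α r')) hz⟩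
  have hnot (n : ℕ) (hn : 1 ≤ n) (hnr : n < r) : (α.toEquiv ^ n) y ∉ Y :=
    pow_apply_notMem_of_lt_firstReturn hn (hy.2.symm ▸ hnr)
  intro h
  rcases le_or_gt i p with hip | hpi
  · refine hnot (r' - p + i) (by omega) (by omega) ?_
    rwa [pow_add, Equiv.Perm.mul_apply, ← h, ← Equiv.Perm.mul_apply, ← pow_add,
      Nat.sub_add_cancel hp.le]
  · refine hnot (i - p) (by omega) (by omega) ?_
    have hz' : z = (α.toEquiv ^ (i - p)) y := by
      apply (α.toEquiv ^ p).injective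
      rw [h, ← Equiv.Perm.mul_apply, ← pow_add, Nat.add_sub_cancel' hpi.le]
    exact hz' ▸ hzY
end
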